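/- Let l be a positive integer, let m be an integer with 2^(2l+1) ≤ m ≤ 2^(2l+2) − 3, and set M = 2^(2l+1) − 2 + m. Let E = A_{2l+1} ∪ (2^(2l+1) − 2 + B_{2l+1}) ∪ (2^(2l+2) − 2 + (B_{2l+1} ∩ [0, 2^(2l+1) − 3])) ∪ {3·2^(2l+1) − 4} and F = B_{2l+1} ∪ (2^(2l+1) − 2 + A_{2l+1}) ∪ (2^(2l+2) − 2 + (A_{2l+1} ∩ [0, 2^(2l+1) − 3])). Suppose C, D ⊆ ℕ satisfy C ∪ D = ℕ, 0 ∈ C, C ∩ D = ((2^(2l+1) − 2) + mℕ) ∪ ((2^(2l+1) − 1) + mℕ), and R_C(n) = R_D(n) for all n ∈ ℕ. Then C ∩ [0, M] = E ∩ [0, M] and D ∩ [0, M − 1] = F ∩ [0, M]. -/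

import Mathlib

/-- `R S n` is the number of pairs `(s, s')` with `s, s' ∈ S`, `s < s'` and `s + s' = n`. -/
noncomputable def R (S : Set ℕ) (n : ℕ) : ℕ :=
  Set.ncard {p : ℕ × ℕ | p.1 ∈ S ∧ p.2 ∈ S ∧ p.1 < p.2 ∧ p.1 + p.2 = n}

/-- `AP r m` is the arithmetic progression `r + mℕ = {r + m*k : k ∈ ℕ}`. -/
def AP (r m : ℕ) : Set ℕ := {n | ∃ k : ℕ, n = r + m * k}

/-- The Thue–Morse set: nonnegative integers with an even number of binary digits 1. -/
def TMA : Set ℕ := {n | Even ((Nat.digits 2 n).sum)}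

/-- Complement of the Thue–Morse set. -/
def TMB : Set ℕ := {n | ¬ Even ((Nat.digits 2 n).sum)}

/-- `TMAl l = A ∩ [0, 2^l - 1]`. -/
def TMAl (l : ℕ) : Set ℕ := TMA ∩ Set.Icc 0 (2 ^ l - 1)

/-- `TMBl l = B ∩ [0, 2^l - 1]`. -/
def TMBl (l : ℕ) : Set ℕ := TMB ∩ Set.Icc 0 (2 ^ l - 1)

/-- The set `E` of Claim 3. -/
def Eset (l : ℕ) : Set ℕ :=
  TMAl (2 * l + 1) ∪ ((fun x => 2 ^ (2 * l + 1) - 2 + x) '' TMBl (2 * l + 1)) ∪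
    ((fun x => 2 ^ (2 * l + 2) - 2 + x) ''
      (TMBl (2 * l + 1) ∩ Set.Icc 0 (2 ^ (2 * l + 1) - 3))) ∪
    {3 * 2 ^ (2 * l + 1) - 4}

/-- The set `F` of Claim 3. -/
def Fset (l : ℕ) : Set ℕ :=
  TMBl (2 * l + 1) ∪ ((fun x => 2 ^ (2 * l + 1) - 2 + x) '' TMAl (2 * l + 1)) ∪
    ((fun x => 2 ^ (2 * l + 2) - 2 + x) ''
      (TMAl (2 * l + 1) ∩ Set.Icc 0 (2 ^ (2 * l + 1) - 3)))

/-- The Thue–Morse sign, `1` on `TMA` and `-1` on `TMB`. -/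
def tmSign (n : ℕ) : ℤ := (-1) ^ (Nat.digits 2 n).sum

lemma tmSign_of_mem {n : ℕ} (h : n ∈ TMA) : tmSign n = 1 := Even.neg_one_pow h

lemma tmSign_of_notMem {n : ℕ} (h : n ∉ TMA) : tmSign n = -1 :=
  Odd.neg_one_pow (Nat.not_even_iff_odd.1 h)

lemma tmSign_two_mul (n : ℕ) : tmSign (2 * n) = tmSign n := by
  rcases Nat.eq_zero_or_pos n with rfl | hn
  · rfl
  · rw [tmSign, Nat.digits_def' one_lt_two (by omega), tmSign]
    simp

lemma tmSign_two_mul_add_one (n : ℕ) : tmSign (2 * n + 1) = -tmSign n := by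
  rw [tmSign, Nat.digits_def' one_lt_two (by omega), tmSign]
  have h1 : (2 * n + 1) % 2 = 1 := by omega
  have h2 : (2 * n + 1) / 2 = n := by omega
  rw [h1, h2, List.sum_cons, pow_add]
  ring

/-- The polynomial `∏ i < k, (1 - X ^ 2 ^ i)`. -/
noncomputable def tmPoly (k : ℕ) : Polynomial ℤ :=
  ∏ i ∈ Finset.range k, (1 - Polynomial.X ^ 2 ^ i)

lemma tmPoly_succ (k : ℕ) :
    tmPoly (k + 1) = tmPoly k * (1 - Polynomial.X ^ 2 ^ k) :=
  Finset.prod_range_succ _ _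

lemma tmPoly_succ_eq_expand (k : ℕ) :
    tmPoly (k + 1) = (1 - Polynomial.X) * Polynomial.expand ℤ 2 (tmPoly k) := by
  rw [tmPoly, Finset.prod_range_succ', tmPoly, map_prod, mul_comm]
  simp [pow_succ', pow_mul]

lemma coeff_tmPoly (k n : ℕ) :
    (tmPoly k).coeff n = if n < 2 ^ k then tmSign n else 0 := by
  induction k generalizing n with
  | zero =>
    rcases Nat.eq_zero_or_pos n with rfl | hn
    · simp [tmPoly, tmSign]
    · simp [tmPoly, Polynomial.coeff_one, hn.ne']
  | succ k ih =>
    rw [tmPoly_succ_eq_expand, sub_mul, one_mul, Polynomial.coeff_sub, pow_succ]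
    obtain ⟨r, rfl | rfl⟩ := Nat.even_or_odd' n
    · have h : (Polynomial.X * Polynomial.expand ℤ 2 (tmPoly k)).coeff (2 * r) = 0 := by
        rcases r with _ | r
        · simp
        · rw [show 2 * (r + 1) = 2 * r + 1 + 1 by ring, Polynomial.coeff_X_mul,
            Polynomial.coeff_expand two_pos, if_neg (by omega)]
      rw [h, Polynomial.coeff_expand two_pos, if_pos (by omega),
        Nat.mul_div_cancel_left _ two_pos, ih, tmSign_two_mul, sub_zero]
      exact if_congr (by omega) rfl rfl
    · rw [Polynomial.coeff_X_mul, Polynomial.coeff_expand two_pos, if_neg (by omega),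
        Polynomial.coeff_expand two_pos, if_pos (by omega),
        Nat.mul_div_cancel_left _ two_pos, ih, tmSign_two_mul_add_one]
      by_cases h : r < 2 ^ k
      · rw [if_pos h, if_pos (by omega), zero_sub]
      · rw [if_neg h, if_neg (by omega), sub_zero]

/-- The polynomial whose coefficients below `3 * 2 ^ k - 4` are the differences of the indicator
functions of `Eset` and `Fset`, where `k = 2 * l + 1`. -/
noncomputable def diffPoly (k : ℕ) : Polynomial ℤ :=
  tmPoly k * (1 - Polynomial.X ^ (2 ^ k - 2) - Polynomial.X ^ (2 * 2 ^ k - 2))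

lemma coeff_diffPoly (k n : ℕ) :
    (diffPoly k).coeff n = (if n < 2 ^ k then tmSign n else 0)
      - (if 2 ^ k - 2 ≤ n ∧ n - (2 ^ k - 2) < 2 ^ k then tmSign (n - (2 ^ k - 2)) else 0)
      - (if 2 * 2 ^ k - 2 ≤ n ∧ n - (2 * 2 ^ k - 2) < 2 ^ k then
          tmSign (n - (2 * 2 ^ k - 2)) else 0) := by
  rw [diffPoly, mul_sub, mul_sub, mul_one, Polynomial.coeff_sub, Polynomial.coeff_sub,
    Polynomial.coeff_mul_X_pow', Polynomial.coeff_mul_X_pow']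
  simp only [coeff_tmPoly, ite_and]

open PowerSeries in
lemma coeff_diffPoly_mul (k : ℕ) (hk : 3 ≤ k) (n : ℕ) (hn : n < 3 * 2 ^ k - 4) :
    coeff n ((diffPoly k : ℤ⟦X⟧) * (mk 1 + X ^ (2 ^ k - 2) + X ^ (2 ^ k - 1))) =
      if 2 ∣ n then (diffPoly k).coeff (n / 2) else 0 := by
  rw [← Polynomial.coeff_expand two_pos, ← Polynomial.coeff_coe, ← sub_eq_zero, ← map_sub]
  refine X_pow_dvd_iff.1 ?_ n hn
  have hN : 2 ^ 3 ≤ 2 ^ k := Nat.pow_le_pow_right two_pos hk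
  obtain ⟨a, ha⟩ : ∃ a, 2 ^ k = a + 2 := ⟨2 ^ k - 2, by omega⟩
  have hone : (1 - X : ℤ⟦X⟧) * mk 1 = 1 := by
    rw [mul_comm]; exact mk_one_mul_one_sub_eq_one ℤ
  have hunit : IsUnit (1 - X : ℤ⟦X⟧) := IsUnit.of_mul_eq_one _ hone
  rw [← hunit.dvd_mul_left]
  have hexp : Polynomial.expand ℤ 2 (diffPoly k) = Polynomial.expand ℤ 2 (tmPoly k) *
      (1 - Polynomial.X ^ (2 * a) - Polynomial.X ^ (4 * a + 4)) := by
    rw [diffPoly, ha]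
    simp only [map_mul, map_sub, map_one, map_pow, Polynomial.expand_X, ← pow_mul]
    congr 3
    all_goals omega
  have hmul : (1 - X) * ((Polynomial.expand ℤ 2 (tmPoly k) : Polynomial ℤ) : ℤ⟦X⟧) =
      (tmPoly k : ℤ⟦X⟧) * (1 - X ^ (a + 2)) := by
    have := congrArg (fun p : Polynomial ℤ => (p : ℤ⟦X⟧))
      ((tmPoly_succ_eq_expand k).symm.trans (tmPoly_succ k))
    simpa [ha] using this
  have hdiff : (diffPoly k : ℤ⟦X⟧) = (tmPoly k : ℤ⟦X⟧) * (1 - X ^ a - X ^ (2 * a + 2)) := by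
    rw [diffPoly, ha, show a + 2 - 2 = a by omega, show 2 * (a + 2) - 2 = 2 * a + 2 by omega]
    simp
  rw [hexp, hdiff, ha, show a + 2 - 2 = a by omega, show a + 2 - 1 = a + 1 by omega,
    show 3 * (a + 2) - 4 = 3 * a + 2 by omega]
  obtain ⟨b, rfl⟩ : ∃ b, a = b + 2 := ⟨a - 2, by omega⟩
  refine ⟨(tmPoly k : ℤ⟦X⟧) * (X ^ 2 - 2 + X ^ (b + 4) * (1 - X ^ (b + 4))), ?_⟩
  simp only [Polynomial.coe_mul, Polynomial.coe_sub, Polynomial.coe_one, Polynomial.coe_pow,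
    Polynomial.coe_X]
  linear_combination (tmPoly k : ℤ⟦X⟧) * (1 - X ^ (b + 2) - X ^ (2 * (b + 2) + 2)) * hone -
    (1 - X ^ (2 * (b + 2)) - X ^ (4 * (b + 2) + 4)) * hmul

/-- A solution of `g * s = g(X ^ 2)` up to degree `K`, where `s` has constant term `1`, is
determined up to degree `K` by its constant term. -/
lemma PowerSeries.coeff_eq_of_mul_eq_expand {s : PowerSeries ℤ} (hs : coeff 0 s = 1) {K : ℕ}
    {g h : PowerSeries ℤ} (h0 : coeff 0 g = coeff 0 h)
    (hg : ∀ n ≤ K, coeff n (g * s) = if 2 ∣ n then coeff (n / 2) g else 0)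
    (hh : ∀ n ≤ K, coeff n (h * s) = if 2 ∣ n then coeff (n / 2) h else 0) :
    ∀ n ≤ K, coeff n g = coeff n h := by
  intro n
  induction n using Nat.strong_induction_on with
  | _ n ih =>
    intro hn
    rcases Nat.eq_zero_or_pos n with rfl | hpos
    · exact h0
    have key : coeff n (g * s) = coeff n (h * s) := by
      rw [hg n hn, hh n hn, ih (n / 2) (by omega) (by omega)]
    rw [coeff_mul, coeff_mul, Finset.Nat.sum_antidiagonal_eq_sum_range_succ_mk,
      Finset.Nat.sum_antidiagonal_eq_sum_range_succ_mk, Finset.sum_range_succ,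
      Finset.sum_range_succ] at key
    have hsum : ∑ i ∈ Finset.range n, coeff i g * coeff (n - i) s =
        ∑ i ∈ Finset.range n, coeff i h * coeff (n - i) s :=
      Finset.sum_congr rfl fun i hi => by
        rw [ih i (Finset.mem_range.1 hi) ((Finset.mem_range.1 hi).le.trans hn)]
    simp only [Nat.sub_self, hs, mul_one] at key
    linarith

open Classical in
/-- The generating function of a set of natural numbers. -/
noncomputable def genFun (S : Set ℕ) : PowerSeries ℤ :=
  PowerSeries.mk fun n => if n ∈ S then 1 else 0

open Classical in
lemma coeff_genFun (S : Set ℕ) (n : ℕ) :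
    PowerSeries.coeff n (genFun S) = if n ∈ S then 1 else 0 :=
  PowerSeries.coeff_mk _ _

open Classical in
lemma R_eq_card (S : Set ℕ) (n : ℕ) :
    R S n = ((Finset.HasAntidiagonal.antidiagonal n).filter
      fun p => (p.1 ∈ S ∧ p.2 ∈ S) ∧ p.1 < p.2).card := by
  rw [R, ← Set.ncard_coe_finset]
  congr 1
  ext p
  simp
  tauto

open Classical in
lemma coeff_genFun_mul_self (S : Set ℕ) (n : ℕ) :
    PowerSeries.coeff n (genFun S * genFun S) =
      2 * R S n + if 2 ∣ n then PowerSeries.coeff (n / 2) (genFun S) else 0 := by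
  have hsplit : ∀ p : ℕ × ℕ,
      PowerSeries.coeff p.1 (genFun S) * PowerSeries.coeff p.2 (genFun S) =
        (if (p.1 ∈ S ∧ p.2 ∈ S) ∧ p.1 < p.2 then 1 else 0) +
        (if (p.2 ∈ S ∧ p.1 ∈ S) ∧ p.2 < p.1 then 1 else 0) +
        (if p.1 = p.2 then PowerSeries.coeff p.1 (genFun S) else 0) := by
    rintro ⟨i, j⟩
    simp only [coeff_genFun]
    rcases lt_trichotomy i j with h | h | h
    · by_cases hi : i ∈ S <;> by_cases hj : j ∈ S <;> simp [hi, hj, h, h.ne, h.not_gt]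
    · subst h
      by_cases hi : i ∈ S <;> simp [hi]
    · by_cases hi : i ∈ S <;> by_cases hj : j ∈ S <;> simp [hi, hj, h, h.ne', h.not_gt]
  have hlt : ∑ p ∈ Finset.HasAntidiagonal.antidiagonal n,
      (if (p.1 ∈ S ∧ p.2 ∈ S) ∧ p.1 < p.2 then 1 else 0 : ℤ) = R S n := by
    rw [R_eq_card, Finset.sum_boole]
  have hgt : ∑ p ∈ Finset.HasAntidiagonal.antidiagonal n,
      (if (p.2 ∈ S ∧ p.1 ∈ S) ∧ p.2 < p.1 then 1 else 0 : ℤ) = R S n := by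
    rw [← hlt]
    exact Finset.Nat.sum_antidiagonal_swap
      (f := fun p : ℕ × ℕ => (if (p.1 ∈ S ∧ p.2 ∈ S) ∧ p.1 < p.2 then 1 else 0 : ℤ))
  have hdiag : ∑ p ∈ Finset.HasAntidiagonal.antidiagonal n,
      (if p.1 = p.2 then PowerSeries.coeff p.1 (genFun S) else 0) =
        if 2 ∣ n then PowerSeries.coeff (n / 2) (genFun S) else 0 := by
    split_ifs with h
    · obtain ⟨r, rfl⟩ := h
      rw [Finset.sum_eq_single (r, r)]
      · simp
      · rintro ⟨i, j⟩ hij hne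
        rw [Finset.HasAntidiagonal.mem_antidiagonal] at hij
        refine if_neg fun h : i = j => hne ?_
        ext <;> simp at * <;> omega
      · intro h
        exact absurd (Finset.HasAntidiagonal.mem_antidiagonal.2 (by simp; ring)) h
    · refine Finset.sum_eq_zero fun p hp => if_neg fun heq => h ?_
      rw [Finset.HasAntidiagonal.mem_antidiagonal] at hp
      omega
  rw [PowerSeries.coeff_mul, Finset.sum_congr rfl fun p _ => hsplit p, Finset.sum_add_distrib,
    Finset.sum_add_distrib, hlt, hgt, hdiag]
  ring

lemma coeff_genFun_sub_mul_add {C D : Set ℕ} (hR : ∀ n, R C n = R D n) (n : ℕ) :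
    PowerSeries.coeff n ((genFun C - genFun D) * (genFun C + genFun D)) =
      if 2 ∣ n then PowerSeries.coeff (n / 2) (genFun C - genFun D) else 0 := by
  rw [show (genFun C - genFun D) * (genFun C + genFun D) =
    genFun C * genFun C - genFun D * genFun D by ring, map_sub, map_sub, coeff_genFun_mul_self,
    coeff_genFun_mul_self, hR]
  split_ifs <;> ring

lemma mem_AP_iff_of_lt {r m n : ℕ} (h : n < r + m) : n ∈ AP r m ↔ n = r := by
  constructor
  · rintro ⟨_ | k, rfl⟩
    · simp
    · rw [mul_add] at h
      omega
  · rintro rfl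
    exact ⟨0, by simp⟩

open PowerSeries in
/-- If `C ∪ D = ℕ`, `0 ∈ C`, `R C = R D`, and `C ∩ D` meets `[0, M]` exactly in
`{2 ^ k - 2, 2 ^ k - 1, M}`, then `diffPoly k` gives the difference of the indicator functions of
`C` and `D` below `M`, and its coefficient at `M` is `1`. -/
lemma coeff_genFun_sub_eq {k M : ℕ} {C D : Set ℕ} (hk : 3 ≤ k) (hM1 : 2 ^ k ≤ M)
    (hM2 : M < 3 * 2 ^ k - 4) (hU : C ∪ D = Set.univ) (h0 : 0 ∈ C)
    (hI : ∀ n ≤ M, n ∈ C ∩ D ↔ n = 2 ^ k - 2 ∨ n = 2 ^ k - 1 ∨ n = M)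
    (hR : ∀ n, R C n = R D n) :
    ∀ n ≤ M, coeff n (genFun C - genFun D) + (if n = M then 1 else 0) =
      (diffPoly k).coeff n := by
  classical
  have hN : 2 ^ 3 ≤ 2 ^ k := Nat.pow_le_pow_right two_pos hk
  have h0D : 0 ∉ D := fun h => by
    have := (hI 0 (by omega)).1 ⟨h0, h⟩
    omega
  set s : ℤ⟦X⟧ := mk 1 + X ^ (2 ^ k - 2) + X ^ (2 ^ k - 1) with hs
  have hs0 : coeff 0 s = 1 := by
    simp [hs, show 2 ^ k - 2 ≠ 0 by omega, show 2 ^ k - 1 ≠ 0 by omega]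
  have hf0 : coeff 0 (genFun C - genFun D) = 1 := by
    rw [map_sub, coeff_genFun, coeff_genFun, if_pos h0, if_neg h0D, sub_zero]
  have hadd : ∀ n ≤ M, coeff n (genFun C + genFun D) = coeff n (s + X ^ M) := by
    intro n hn
    have hor : n ∈ C ∨ n ∈ D := by
      rw [← Set.mem_union, hU]
      trivial
    have hin := hI n hn
    rw [Set.mem_inter_iff] at hin
    simp only [hs, map_add, coeff_genFun, coeff_mk, coeff_X_pow, Pi.one_apply]
    by_cases h : n ∈ C ∧ n ∈ D
    · rw [if_pos h.1, if_pos h.2]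
      rcases hin.1 h with h1 | h1 | h1
      · rw [if_pos h1, if_neg (by omega), if_neg (by omega)]; rfl
      · rw [if_neg (by omega), if_pos h1, if_neg (by omega)]; rfl
      · rw [if_neg (by omega), if_neg (by omega), if_pos h1]; rfl
    · have hn' := mt hin.2 h
      push Not at hn'
      rw [if_neg hn'.1, if_neg hn'.2.1, if_neg hn'.2.2]
      rcases hor with h1 | h1
      · rw [if_pos h1, if_neg fun h2 => h ⟨h1, h2⟩]; rfl
      · rw [if_pos h1, if_neg fun h2 => h ⟨h2, h1⟩]; rfl
  have hmul : ∀ n ≤ M, coeff n ((genFun C - genFun D + X ^ M) * s) =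
      if 2 ∣ n then coeff (n / 2) (genFun C - genFun D + X ^ M) else 0 := by
    intro n hn
    have h1 : coeff n ((genFun C - genFun D) * (genFun C + genFun D)) =
        coeff n ((genFun C - genFun D) * (s + X ^ M)) := by
      rw [coeff_mul, coeff_mul]
      refine Finset.sum_congr rfl fun p hp => ?_
      rw [hadd p.2 (by rw [Finset.HasAntidiagonal.mem_antidiagonal] at hp; omega)]
    have h2 : ∀ g : ℤ⟦X⟧, coeff 0 g = 1 → coeff n (g * X ^ M) = if n = M then 1 else 0 := by
      intro g hg
      rw [coeff_mul_X_pow']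
      by_cases h : n = M
      · rw [if_pos h.ge, if_pos h, h, Nat.sub_self, hg]
      · rw [if_neg (by omega), if_neg h]
    have h3 : coeff (n / 2) (X ^ M : ℤ⟦X⟧) = 0 := by
      rw [coeff_X_pow, if_neg (by omega)]
    rw [map_add _ _ (X ^ M), h3, add_zero, ← coeff_genFun_sub_mul_add hR, h1, add_mul, mul_add _ s,
      map_add, map_add, h2 _ hf0, mul_comm (X ^ M), h2 _ hs0]
  have hd0 : coeff 0 (genFun C - genFun D + X ^ M) = coeff 0 (diffPoly k : ℤ⟦X⟧) := by
    rw [map_add, hf0, coeff_X_pow, if_neg (by omega), Polynomial.coeff_coe, coeff_diffPoly,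
      if_pos (by omega), if_neg (by omega), if_neg (by omega)]
    rfl
  intro n hn
  have := coeff_eq_of_mul_eq_expand hs0 hd0 hmul (fun n hn => by
    rw [coeff_diffPoly_mul k hk n (by omega), Polynomial.coeff_coe]) n hn
  rwa [map_add, coeff_X_pow, Polynomial.coeff_coe] at this

lemma mem_TMAl_iff {k n : ℕ} : n ∈ TMAl k ↔ n ∈ TMA ∧ n < 2 ^ k := by
  have := Nat.two_pow_pos k
  rw [TMAl, Set.mem_inter_iff, Set.mem_Icc]
  exact and_congr_right fun _ => by omega

lemma mem_TMBl_iff {k n : ℕ} : n ∈ TMBl k ↔ n ∉ TMA ∧ n < 2 ^ k := by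
  have := Nat.two_pow_pos k
  rw [TMBl, Set.mem_inter_iff, Set.mem_Icc]
  exact and_congr Iff.rfl (by omega)

lemma mem_image_add_left_iff {a n : ℕ} {S : Set ℕ} :
    n ∈ (fun x => a + x) '' S ↔ a ≤ n ∧ n - a ∈ S := by
  constructor
  · rintro ⟨x, hx, rfl⟩
    exact ⟨Nat.le_add_right _ _, by simpa using hx⟩
  · rintro ⟨h, hn⟩
    exact ⟨n - a, hn, by simp [h]⟩

lemma mem_Eset_iff {l n : ℕ} (hl : 0 < l) (hn : n < 3 * 2 ^ (2 * l + 1) - 4) :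
    n ∈ Eset l ↔ (n < 2 ^ (2 * l + 1) ∧ n ∈ TMA) ∨
      (2 ^ (2 * l + 1) - 2 ≤ n ∧ n < 2 * 2 ^ (2 * l + 1) - 2 ∧
        n - (2 ^ (2 * l + 1) - 2) ∉ TMA) ∨
      (2 * 2 ^ (2 * l + 1) - 2 ≤ n ∧ n - (2 * 2 ^ (2 * l + 1) - 2) ∉ TMA) := by
  have hN : 2 ^ 3 ≤ 2 ^ (2 * l + 1) := Nat.pow_le_pow_right two_pos (by omega)
  simp only [Eset, Set.mem_union, Set.mem_inter_iff, mem_image_add_left_iff, mem_TMAl_iff,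
    mem_TMBl_iff, Set.mem_Icc, Set.mem_singleton_iff,
    show 2 ^ (2 * l + 2) = 2 * 2 ^ (2 * l + 1) by ring]
  generalize 2 ^ (2 * l + 1) = N at *
  grind

lemma mem_Fset_iff {l n : ℕ} (hl : 0 < l) (hn : n < 3 * 2 ^ (2 * l + 1) - 4) :
    n ∈ Fset l ↔ (n < 2 ^ (2 * l + 1) ∧ n ∉ TMA) ∨
      (2 ^ (2 * l + 1) - 2 ≤ n ∧ n < 2 * 2 ^ (2 * l + 1) - 2 ∧
        n - (2 ^ (2 * l + 1) - 2) ∈ TMA) ∨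
      (2 * 2 ^ (2 * l + 1) - 2 ≤ n ∧ n - (2 * 2 ^ (2 * l + 1) - 2) ∈ TMA) := by
  have hN : 2 ^ 3 ≤ 2 ^ (2 * l + 1) := Nat.pow_le_pow_right two_pos (by omega)
  simp only [Fset, Set.mem_union, Set.mem_inter_iff, mem_image_add_left_iff, mem_TMAl_iff,
    mem_TMBl_iff, Set.mem_Icc,
    show 2 ^ (2 * l + 2) = 2 * 2 ^ (2 * l + 1) by ring]
  generalize 2 ^ (2 * l + 1) = N at *
  grind

lemma tmSign_two_pow_sub_one (k : ℕ) : tmSign (2 ^ k - 1) = (-1) ^ k := by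
  induction k with
  | zero => rfl
  | succ k ih =>
    have := Nat.two_pow_pos k
    rw [show 2 ^ (k + 1) - 1 = 2 * (2 ^ k - 1) + 1 by omega, tmSign_two_mul_add_one, ih, pow_succ]
    ring

lemma mem_TMA_iff {n : ℕ} : n ∈ TMA ↔ tmSign n = 1 :=
  ⟨tmSign_of_mem, fun h => by
    by_contra hn
    rw [tmSign_of_notMem hn] at h
    norm_num at h⟩

lemma two_pow_sub_one_notMem_TMA (l : ℕ) : 2 ^ (2 * l + 1) - 1 ∉ TMA := by
  rw [mem_TMA_iff, tmSign_two_pow_sub_one, pow_succ, pow_mul]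
  norm_num

lemma two_pow_sub_two_mem_TMA (l : ℕ) : 2 ^ (2 * l + 1) - 2 ∈ TMA := by
  rw [show 2 ^ (2 * l + 1) - 2 = 2 * (2 ^ (2 * l) - 1) by omega, mem_TMA_iff, tmSign_two_mul,
    tmSign_two_pow_sub_one, pow_mul]
  norm_num

lemma zero_mem_TMA : 0 ∈ TMA := by simp [TMA]

lemma one_notMem_TMA : 1 ∉ TMA := by simp [TMA]

lemma mem_Eset_or_mem_Fset {l n : ℕ} (hl : 0 < l) (hn : n < 3 * 2 ^ (2 * l + 1) - 4) :
    n ∈ Eset l ∨ n ∈ Fset l := by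
  rw [mem_Eset_iff hl hn, mem_Fset_iff hl hn]
  have hN : 2 ^ 3 ≤ 2 ^ (2 * l + 1) := Nat.pow_le_pow_right two_pos (by omega)
  generalize 2 ^ (2 * l + 1) = N at *
  grind

lemma mem_Eset_and_mem_Fset_iff {l n : ℕ} (hl : 0 < l) (hn : n < 3 * 2 ^ (2 * l + 1) - 4) :
    n ∈ Eset l ∧ n ∈ Fset l ↔ n = 2 ^ (2 * l + 1) - 2 ∨ n = 2 ^ (2 * l + 1) - 1 := by
  rw [mem_Eset_iff hl hn, mem_Fset_iff hl hn]
  have hN : 2 ^ 3 ≤ 2 ^ (2 * l + 1) := Nat.pow_le_pow_right two_pos (by omega)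
  have h1 := two_pow_sub_one_notMem_TMA l
  have h2 := two_pow_sub_two_mem_TMA l
  have h3 := zero_mem_TMA
  have h4 := one_notMem_TMA
  generalize 2 ^ (2 * l + 1) = N at *
  obtain ⟨a, rfl⟩ : ∃ a, N = a + 2 := ⟨N - 2, by omega⟩
  rw [show a + 2 - 2 = a by omega, show a + 2 - 1 = a + 1 by omega] at *
  by_cases ha : n = a
  · subst ha
    simp [h2, h3]
    omega
  by_cases ha' : n = a + 1
  · subst ha'
    simp [h1, h4]
    omega
  grind

open Classical in
lemma coeff_diffPoly_eq_indicator {l n : ℕ} (hl : 0 < l)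
    (hn : n < 3 * 2 ^ (2 * l + 1) - 4) :
    (diffPoly (2 * l + 1)).coeff n =
      (if n ∈ Eset l then 1 else 0) - (if n ∈ Fset l then 1 else 0) := by
  have hand := mem_Eset_and_mem_Fset_iff hl hn
  have hN : 2 ^ 3 ≤ 2 ^ (2 * l + 1) := Nat.pow_le_pow_right two_pos (by omega)
  have h1 := tmSign_of_notMem (two_pow_sub_one_notMem_TMA l)
  have h2 := tmSign_of_mem (two_pow_sub_two_mem_TMA l)
  have h3 := tmSign_of_mem zero_mem_TMA
  have h4 := tmSign_of_notMem one_notMem_TMA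
  have hE := mem_Eset_iff hl hn
  have hF := mem_Fset_iff hl hn
  rw [coeff_diffPoly]
  generalize 2 ^ (2 * l + 1) = N at *
  by_cases hand' : n = N - 2 ∨ n = N - 1
  · rw [if_pos (hand.2 hand').1, if_pos (hand.2 hand').2]
    rcases hand' with rfl | rfl
    · rw [if_pos (by omega), if_pos (by omega), if_neg (by omega), Nat.sub_self, h2, h3]
      rfl
    · rw [if_pos (by omega), if_pos (by omega), if_neg (by omega),
        show N - 1 - (N - 2) = 1 by omega, h1, h4]
      rfl
  rcases lt_or_ge n N with h | h
  · rw [if_pos h, if_neg (by omega), if_neg (by omega)]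
    by_cases hA : n ∈ TMA
    · rw [tmSign_of_mem hA, if_pos (by grind), if_neg (by grind)]
      rfl
    · rw [tmSign_of_notMem hA, if_neg (by grind), if_pos (by grind)]
      rfl
  rcases lt_or_ge n (2 * N - 2) with h' | h'
  · rw [if_neg (by omega), if_pos (by omega), if_neg (by omega)]
    by_cases hA : n - (N - 2) ∈ TMA
    · rw [tmSign_of_mem hA, if_neg (by grind), if_pos (by grind)]
      rfl
    · rw [tmSign_of_notMem hA, if_pos (by grind), if_neg (by grind)]
      rfl
  · rw [if_neg (by omega), if_neg (by omega), if_pos (by omega)]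
    by_cases hA : n - (2 * N - 2) ∈ TMA
    · rw [tmSign_of_mem hA, if_neg (by grind), if_pos (by grind)]
      rfl
    · rw [tmSign_of_notMem hA, if_pos (by grind), if_neg (by grind)]
      rfl

theorem stmt_17 (l : ℕ) (hl : 0 < l) (m : ℕ) (hm1 : 2 ^ (2 * l + 1) ≤ m)
    (hm2 : m ≤ 2 ^ (2 * l + 2) - 3) (C D : Set ℕ)
    (hU : C ∪ D = Set.univ) (h0 : 0 ∈ C)
    (hI : C ∩ D = AP (2 ^ (2 * l + 1) - 2) m ∪ AP (2 ^ (2 * l + 1) - 1) m)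
    (hR : ∀ n : ℕ, R C n = R D n) :
    C ∩ Set.Icc 0 (2 ^ (2 * l + 1) - 2 + m) =
      Eset l ∩ Set.Icc 0 (2 ^ (2 * l + 1) - 2 + m) ∧
    D ∩ Set.Icc 0 (2 ^ (2 * l + 1) - 2 + m - 1) =
      Fset l ∩ Set.Icc 0 (2 ^ (2 * l + 1) - 2 + m) := by
  classical
  have hN : 2 ^ 3 ≤ 2 ^ (2 * l + 1) := Nat.pow_le_pow_right two_pos (by omega)
  have hm2' : m ≤ 2 * 2 ^ (2 * l + 1) - 3 := by
    rwa [show 2 * 2 ^ (2 * l + 1) = 2 ^ (2 * l + 2) by ring]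
  have hM2 : 2 ^ (2 * l + 1) - 2 + m < 3 * 2 ^ (2 * l + 1) - 4 := by omega
  have hI' : ∀ n ≤ 2 ^ (2 * l + 1) - 2 + m, n ∈ C ∩ D ↔
      n = 2 ^ (2 * l + 1) - 2 ∨ n = 2 ^ (2 * l + 1) - 1 ∨ n = 2 ^ (2 * l + 1) - 2 + m := by
    intro n hn
    rw [hI, Set.mem_union, mem_AP_iff_of_lt (r := 2 ^ (2 * l + 1) - 1) (by omega)]
    rcases hn.lt_or_eq with h | rfl
    · rw [mem_AP_iff_of_lt h]
      omega
    · have : 2 ^ (2 * l + 1) - 2 + m ∈ AP (2 ^ (2 * l + 1) - 2) m := ⟨1, by ring⟩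
      tauto
  have hkey : ∀ n ≤ 2 ^ (2 * l + 1) - 2 + m,
      (n ∈ C ↔ n ∈ Eset l) ∧ (n ∈ D ∧ n ≠ 2 ^ (2 * l + 1) - 2 + m ↔ n ∈ Fset l) := by
    intro n hn
    have hc := coeff_genFun_sub_eq (by omega) (by omega) hM2 hU h0 hI' hR n hn
    rw [coeff_diffPoly_eq_indicator hl (hn.trans_lt hM2), map_sub, coeff_genFun,
      coeff_genFun] at hc
    have hor : n ∈ C ∨ n ∈ D := by
      rw [← Set.mem_union, hU]
      trivial
    have hand := hI' n hn
    rw [Set.mem_inter_iff] at hand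
    have hor' := mem_Eset_or_mem_Fset hl (hn.trans_lt hM2)
    have hand' := mem_Eset_and_mem_Fset_iff hl (hn.trans_lt hM2)
    generalize 2 ^ (2 * l + 1) = N at *
    by_cases hC : n ∈ C <;> by_cases hD : n ∈ D <;> by_cases hE : n ∈ Eset l <;>
      by_cases hF : n ∈ Fset l <;> simp only [hC, hD, hE, hF] at * <;> grind
  constructor
  · ext n
    rw [Set.mem_inter_iff, Set.mem_inter_iff, Set.mem_Icc]
    exact and_congr_left fun h => (hkey n h.2).1
  · ext n
    rw [Set.mem_inter_iff, Set.mem_inter_iff, Set.mem_Icc, Set.mem_Icc]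
    constructor
    · rintro ⟨hD, h⟩
      exact ⟨(hkey n (by omega)).2.1 ⟨hD, by omega⟩, by omega⟩
    · rintro ⟨hF, h⟩
      have := (hkey n h.2).2.2 hF
      exact ⟨this.1, by omega⟩
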